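/- arXiv:1210.2050 — 2 statements merged into one kernel-verified Lean document; each statement's English description precedes it below -/
import Mathlib

section
/- Let (𝒫, ℒ) be a linear space, 𝒮 ⊆ 𝒫 a subset, and A, B ∈ 𝒫 points. If B ∈ (𝒮 ∨ {A}) \ ⟨𝒮⟩ and A and B are collinear with some point X ∈ ⟨𝒮⟩ (i.e., some line contains A, B and X), then A ∈ 𝒮 ∨ {B}. -/
/-- A linear space: a point set `P` together with a set of lines (subsets of `P`),
each line having at least two points, and any two distinct points lying on
exactly one line. -/
structure LinearSpace (P : Type*) where
  lines : Set (Set P)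
  two_points : ∀ l ∈ lines, ∃ A B : P, A ≠ B ∧ A ∈ l ∧ B ∈ l
  unique_line : ∀ A B : P, A ≠ B → ∃! l, l ∈ lines ∧ A ∈ l ∧ B ∈ l

namespace LinearSpace

variable {P : Type*} (LS : LinearSpace P)

/-- A subspace: a subset containing, with any two of its distinct points,
the line joining them. -/
def IsSubspace (S : Set P) : Prop :=
  ∀ l ∈ LS.lines, ∀ A ∈ l, ∀ B ∈ l, A ≠ B → A ∈ S → B ∈ S → l ⊆ S

/-- The span of a subset: the intersection of all subspaces containing it. -/
def span (S : Set P) : Set P :=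
  ⋂₀ {T | LS.IsSubspace T ∧ S ⊆ T}

/-- The dimension of a subset `S` (intended for subspaces):
`min {#X - 1 | X ⊆ S, span X = S}` as an extended natural number. -/
noncomputable def sdim (S : Set P) : ℕ∞ :=
  sInf {d : ℕ∞ | ∃ X : Set P, X ⊆ S ∧ LS.span X = S ∧ d = X.encard - 1}

/-- The dimension of the linear space: `min {#X - 1 | span X = P}`. -/
noncomputable def dim : ℕ∞ := LS.sdim Set.univ

/-- A plane is a 2-dimensional subspace. -/
def IsPlane (E : Set P) : Prop := LS.IsSubspace E ∧ LS.sdim E = 2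

/-- A generalized projective space: every plane is a generalized projective
plane, i.e. any two distinct lines contained in a common plane meet. -/
def IsGenProjSpace : Prop :=
  ∀ E : Set P, LS.IsPlane E →
    ∀ l ∈ LS.lines, ∀ m ∈ LS.lines, l ⊆ E → m ⊆ E → l ≠ m → (l ∩ m).Nonempty

/-- A related set: a set of lines which pairwise meet. -/
def IsRelatedSet (N : Set (Set P)) : Prop :=
  N ⊆ LS.lines ∧ ∀ a ∈ N, ∀ b ∈ N, (a ∩ b).Nonempty

/-- A maximal related set: a related set maximal with respect to inclusion. -/
def IsMaxRelatedSet (M : Set (Set P)) : Prop :=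
  LS.IsRelatedSet M ∧ ∀ N, LS.IsRelatedSet N → M ⊆ N → N = M

/-- The star of lines with vertex `A`: all lines through `A`. -/
def star (A : P) : Set (Set P) := {l | l ∈ LS.lines ∧ A ∈ l}

/-- The pencil of planes with axis `a`: all planes containing `a`. -/
def pencil (a : Set P) : Set (Set P) := {E | LS.IsPlane E ∧ a ⊆ E}

/-- A collineation: a bijection of the point sets mapping each line onto a
line, and whose inverse does likewise. -/
def IsCollineation {P' : Type*} (LS' : LinearSpace P') (κ : P → P') : Prop :=
  Function.Bijective κ ∧ (∀ l ∈ LS.lines, κ '' l ∈ LS'.lines) ∧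
    (∀ l' ∈ LS'.lines, κ ⁻¹' l' ∈ LS.lines)

end LinearSpace

/-- If `B ∈ (S ∨ {A}) \ ⟨S⟩` and `A, B` are collinear with some point
`X ∈ ⟨S⟩`, then `A ∈ S ∨ {B}`. -/
theorem exchange_of_collinear_with_span_point
    {P : Type*} (LS : LinearSpace P) (S : Set P) (A B : P)
    (hB : B ∈ LS.span (S ∪ {A}) \ LS.span S)
    (hcol : ∃ l ∈ LS.lines, A ∈ l ∧ B ∈ l ∧ ∃ X ∈ LS.span S, X ∈ l) :
    A ∈ LS.span (S ∪ {B}) := by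
  obtain ⟨l, hl, hAl, hBl, X, hX, hXl⟩ := hcol
  have hXB : X ≠ B := by
    rintro rfl
    exact hB.2 hX
  rintro T ⟨hT, hST⟩
  have hXT : X ∈ T := hX T ⟨hT, Set.subset_union_left.trans hST⟩
  have hBT : B ∈ T := hST (Or.inr rfl)
  exact hT l hl X hXl B hBl hXB hXT hBT hAl
end

section
/- Let (𝒫, ℒ) be a generalized projective space, 𝒮 ⊆ 𝒫 a nonempty subset, and X ∈ 𝒫 \ ⟨𝒮⟩. Then 𝒮 ∨ {X} equals the union, over all points Y ∈ ⟨𝒮⟩, of the joins {X} ∨ {Y} (i.e., of the lines through X and Y). -/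
namespace LinearSpace

variable {P : Type*} (LS : LinearSpace P)

theorem subset_span (S : Set P) : S ⊆ LS.span S :=
  Set.subset_sInter fun _ hT => hT.2

variable {LS} in
theorem IsSubspace.span_subset {S T : Set P} (hT : LS.IsSubspace T) (hST : S ⊆ T) :
    LS.span S ⊆ T :=
  Set.sInter_subset_of_mem ⟨hT, hST⟩

theorem isSubspace_span (S : Set P) : LS.IsSubspace (LS.span S) := by
  intro l hl A hA B hB hAB hAS hBS
  refine Set.subset_sInter fun T hT => ?_
  exact hT.1 l hl A hA B hB hAB (hAS T hT) (hBS T hT)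

theorem span_mono {S T : Set P} (h : S ⊆ T) : LS.span S ⊆ LS.span T :=
  (LS.isSubspace_span T).span_subset (h.trans (LS.subset_span T))

variable {LS} in
theorem isSubspace_of_mem_lines {l : Set P} (hl : l ∈ LS.lines) : LS.IsSubspace l := by
  intro m hm A hA B hB hAB hAl hBl
  rw [(LS.unique_line A B hAB).unique ⟨hm, hA, hB⟩ ⟨hl, hAl, hBl⟩]

theorem isSubspace_of_subsingleton {S : Set P} (hS : S.Subsingleton) : LS.IsSubspace S :=
  fun _ _ _ _ _ _ hAB hA hB => absurd (hS hA hB) hAB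

/-- A set that spans two distinct points and is not contained in a line has at least
three points. -/
theorem three_le_encard_of_span_not_subset_line {S : Set P} (hS : (LS.span S).Nontrivial)
    (h : ∀ l ∈ LS.lines, ¬ LS.span S ⊆ l) : 3 ≤ S.encard := by
  have hnt : S.Nontrivial := by
    by_contra hn
    rw [Set.not_nontrivial_iff] at hn
    exact Set.not_subsingleton_iff.2 hS
      (hn.anti ((LS.isSubspace_of_subsingleton hn).span_subset subset_rfl))
  obtain ⟨a, ha, b, hb, hab⟩ := hnt
  obtain ⟨l, ⟨hl, hal, hbl⟩, -⟩ := LS.unique_line a b hab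
  have hSl : ¬ S ⊆ l := fun hSl => h l hl ((isSubspace_of_mem_lines hl).span_subset hSl)
  obtain ⟨c, hc, hcl⟩ := Set.not_subset.1 hSl
  have hac : a ≠ c := by rintro rfl; exact hcl hal
  have hbc : b ≠ c := by rintro rfl; exact hcl hbl
  have hsub : ({a, b, c} : Set P) ⊆ S := by
    rintro x (rfl | rfl | rfl) <;> assumption
  rw [← Set.encard_eq_three.2 ⟨a, b, c, hab, hac, hbc, rfl⟩]
  exact Set.encard_le_encard hsub

/-- Three non-collinear points span a plane. -/
theorem isPlane_span_triple {A B C : P} (hAB : A ≠ B)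
    (h : ∀ l ∈ LS.lines, A ∈ l → B ∈ l → C ∉ l) : LS.IsPlane (LS.span {A, B, C}) := by
  refine ⟨LS.isSubspace_span _, ?_⟩
  have hsub := LS.subset_span {A, B, C}
  have hA : A ∈ LS.span {A, B, C} := hsub (by simp)
  have hB : B ∈ LS.span {A, B, C} := hsub (by simp)
  have hC : C ∈ LS.span {A, B, C} := hsub (by simp)
  obtain ⟨l, ⟨hl, hAl, hBl⟩, -⟩ := LS.unique_line A B hAB
  have hCl := h l hl hAl hBl
  have hAC : A ≠ C := by rintro rfl; exact hCl hAl
  have hBC : B ≠ C := by rintro rfl; exact hCl hBl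
  have h31 : (3 : ℕ∞) - 1 = 2 := rfl
  apply le_antisymm
  · refine sInf_le ⟨{A, B, C}, hsub, rfl, ?_⟩
    rw [Set.encard_eq_three.2 ⟨A, B, C, hAB, hAC, hBC, rfl⟩, h31]
  · refine le_sInf ?_
    rintro d ⟨S, -, hS, rfl⟩
    rw [← h31]
    refine tsub_le_tsub_right (LS.three_le_encard_of_span_not_subset_line ?_ ?_) 1
    · rw [hS]
      exact ⟨A, hA, B, hB, hAB⟩
    · intro m hm hSm
      rw [hS] at hSm
      exact h m hm (hSm hA) (hSm hB) (hSm hC)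

/-- In a generalized projective space, the lines joining a point `X` to the points of a
subspace not containing `X` cover a subspace. -/
theorem IsGenProjSpace.isSubspace_iUnion_span_pair {LS : LinearSpace P}
    (hGPS : LS.IsGenProjSpace) {T : Set P} (hT : LS.IsSubspace T) {X : P} (hX : X ∉ T) :
    LS.IsSubspace (⋃ Y ∈ T, LS.span ({X} ∪ {Y})) := by
  intro l hl Q hQl R hRl hQR hQ hR Z hZl
  simp only [Set.mem_iUnion, exists_prop] at hQ hR ⊢
  obtain ⟨A, hA, hQA⟩ := hQ
  obtain ⟨B, hB, hRB⟩ := hR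
  by_cases hZX : Z = X
  · exact ⟨A, hA, LS.subset_span _ (by simp [hZX])⟩
  by_cases hAB : A = B
  · subst hAB
    exact ⟨A, hA, LS.isSubspace_span _ l hl Q hQl R hRl hQR hQA hRB hZl⟩
  obtain ⟨m, ⟨hm, hAm, hBm⟩, -⟩ := LS.unique_line A B hAB
  obtain ⟨n, ⟨hn, hZn, hXn⟩, -⟩ := LS.unique_line Z X hZX
  have hmT : m ⊆ T := hT m hm A hAm B hBm hAB hA hB
  have hE : LS.IsPlane (LS.span {A, B, X}) :=
    LS.isPlane_span_triple hAB fun k hk hAk hBk hXk =>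
      hX (hT k hk A hAk B hBk hAB hA hB hXk)
  have hsub := LS.subset_span {A, B, X}
  have hXE : X ∈ LS.span {A, B, X} := hsub (by simp)
  have hmE := hE.1 m hm A hAm B hBm hAB (hsub (by simp)) (hsub (by simp))
  have hQE : Q ∈ LS.span {A, B, X} := LS.span_mono (by grind) hQA
  have hRE : R ∈ LS.span {A, B, X} := LS.span_mono (by grind) hRB
  have hZE := hE.1 l hl Q hQl R hRl hQR hQE hRE hZl
  have hnE := hE.1 n hn Z hZn X hXn hZX hZE hXE
  have hmn : m ≠ n := by
    rintro rfl
    exact hX (hmT hXn)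
  obtain ⟨Y, hYm, hYn⟩ := hGPS _ hE m hm n hn hmE hnE hmn
  have hXY : X ≠ Y := by
    rintro rfl
    exact hX (hmT hYm)
  exact ⟨Y, hmT hYm, LS.isSubspace_span _ n hn X hXn Y hYn hXY
    (LS.subset_span _ (by simp)) (LS.subset_span _ (by simp)) hZn⟩

end LinearSpace

/-- In a generalized projective space, for nonempty `S` and `X ∉ ⟨S⟩`,
`S ∨ {X}` is the union of the joins `{X} ∨ {Y}` over all `Y ∈ ⟨S⟩`. -/
theorem join_point_eq_iUnion_lines
    {P : Type*} (LS : LinearSpace P) (hGPS : LS.IsGenProjSpace)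
    (S : Set P) (hS : S.Nonempty) (X : P) (hX : X ∉ LS.span S) :
    LS.span (S ∪ {X}) = ⋃ Y ∈ LS.span S, LS.span ({X} ∪ {Y}) := by
  apply Set.Subset.antisymm
  · refine (hGPS.isSubspace_iUnion_span_pair (LS.isSubspace_span S) hX).span_subset ?_
    obtain ⟨A, hA⟩ := hS
    rintro Z (hZ | rfl)
    · exact Set.mem_biUnion (LS.subset_span S hZ) (LS.subset_span _ (by simp))
    · exact Set.mem_biUnion (LS.subset_span S hA) (LS.subset_span _ (by simp))
  · refine Set.iUnion₂_subset fun Y hY => (LS.isSubspace_span _).span_subset ?_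
    rintro Z (rfl | rfl)
    · exact LS.subset_span _ (by simp)
    · exact LS.span_mono Set.subset_union_left hY
end
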